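/- arXiv:2502.16621 — 2 statements merged into one kernel-verified Lean document; each statement's English description precedes it below -/
import Mathlib

section
/- Let X be a finite set and let L_1, …, L_k be subsets of X with X = L_1 ∪ … ∪ L_k such that for every x ∈ X the index set {i : x ∈ L_i} is a nonempty set of consecutive integers. Suppose σ_1, …, σ_k are linear orders of L_1, …, L_k respectively, such that for every i ∈ {1,…,k−1} and all x, y ∈ L_i ∩ L_{i+1}, x ≤_{σ_i} y if and only if x ≤_{σ_{i+1}} y. Then there exists a linear order σ of X such that for every i ∈ {1,…,k} the restriction of σ to L_i equals σ_i. -/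
/-- `σ` is a linear order of the subset `L` of `X`: it relates only elements of `L`,
is reflexive on `L`, transitive, antisymmetric, and total on `L`. -/
def IsLinOrderOn {X : Type*} (L : Set X) (σ : X → X → Prop) : Prop :=
  (∀ x y, σ x y → x ∈ L ∧ y ∈ L) ∧
  (∀ x ∈ L, σ x x) ∧
  (∀ x y z, σ x y → σ y z → σ x z) ∧
  (∀ x y, σ x y → σ y x → x = y) ∧
  (∀ x ∈ L, ∀ y ∈ L, σ x y ∨ σ y x)

/-- The restriction of the order `σ` to the subset `L`. -/
def restrictRel {X : Type*} (σ : X → X → Prop) (L : Set X) : X → X → Prop :=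
  fun x y => x ∈ L ∧ y ∈ L ∧ σ x y

theorem IsLinOrderOn.restrict {X : Type*} {L : Set X} {σ : X → X → Prop}
    (h : IsLinOrderOn Set.univ σ) : IsLinOrderOn L (restrictRel σ L) := by
  obtain ⟨-, hr, ht, ha, htot⟩ := h
  exact ⟨fun x y h => ⟨h.1, h.2.1⟩, fun x hx => ⟨hx, hx, hr x trivial⟩,
    fun x y z h h' => ⟨h.1, h'.2.1, ht x y z h.2.2 h'.2.2⟩,
    fun x y h h' => ha x y h.2.2 h'.2.2,
    fun x hx y hy => (htot x trivial y trivial).imp (⟨hx, hy, ·⟩) (⟨hy, hx, ·⟩)⟩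

/-- A linear order of `X` containing a linear order of `L` restricts to it. -/
theorem IsLinOrderOn.restrictRel_eq_of_le {X : Type*} {L : Set X} {σ τ : X → X → Prop}
    (hσ : IsLinOrderOn Set.univ σ) (hτ : IsLinOrderOn L τ) (hle : ∀ x y, τ x y → σ x y) :
    restrictRel σ L = τ := by
  obtain ⟨-, -, -, ha, -⟩ := hσ
  obtain ⟨hm, hr, -, -, htot⟩ := hτ
  funext x y
  refine propext ⟨fun ⟨hx, hy, hxy⟩ => ?_, fun h => ⟨(hm x y h).1, (hm x y h).2, hle x y h⟩⟩
  rcases htot x hx y hy with h | h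
  · exact h
  · exact ha x y hxy (hle y x h) ▸ hr x hx

/-- Linear orders of two subsets that agree on the intersection have a common extension to a
linear order of the whole type. -/
theorem IsLinOrderOn.exists_amalgam {X : Type*} {A B : Set X} {τ ρ : X → X → Prop}
    (hτ : IsLinOrderOn A τ) (hρ : IsLinOrderOn B ρ)
    (hagree : ∀ x ∈ A ∩ B, ∀ y ∈ A ∩ B, (τ x y ↔ ρ x y)) :
    ∃ σ : X → X → Prop, IsLinOrderOn Set.univ σ ∧
      (∀ x y, τ x y → σ x y) ∧ ∀ x y, ρ x y → σ x y := by
  obtain ⟨hm, -, ht, ha, -⟩ := hτ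
  obtain ⟨hm', -, ht', ha', -⟩ := hρ
  have hag : ∀ x y, x ∈ A → x ∈ B → y ∈ A → y ∈ B → (τ x y ↔ ρ x y) :=
    fun x y h1 h2 h3 h4 => hagree x ⟨h1, h2⟩ y ⟨h3, h4⟩
  clear hagree
  let P : X → X → Prop := fun x y =>
    x = y ∨ τ x y ∨ ρ x y ∨ (∃ z, τ x z ∧ ρ z y) ∨ ∃ z, ρ x z ∧ τ z y
  have hP : IsPartialOrder X P :=
    { refl := fun x => Or.inl rfl
      trans := by
        rintro x y z (rfl | h | h | ⟨u, h, h1⟩ | ⟨u, h, h1⟩)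
          (rfl | h' | h' | ⟨v, h', h1'⟩ | ⟨v, h', h1'⟩) <;> grind
      antisymm := by
        rintro x y (rfl | h | h | ⟨u, h, h1⟩ | ⟨u, h, h1⟩)
          (h' | h' | h' | ⟨v, h', h1'⟩ | ⟨v, h', h1'⟩) <;> grind }
  obtain ⟨σ, hσ, hle⟩ := extend_partialOrder P
  exact ⟨σ, ⟨fun _ _ _ => ⟨trivial, trivial⟩, fun x _ => hσ.refl x, hσ.trans, hσ.antisymm,
      fun x _ y _ => hσ.total x y⟩,
    fun x y h => hle x y (Or.inr (Or.inl h)), fun x y h => hle x y (Or.inr (Or.inr (Or.inl h)))⟩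

/-- Let `X` be a finite set and `L 0, …, L (k-1)` subsets covering `X` such that for every
`x ∈ X` the set of indices `i < k` with `x ∈ L i` is nonempty and consists of consecutive
integers. If `σs 0, …, σs (k-1)` are linear orders of `L 0, …, L (k-1)` such that adjacent
orders agree on the common elements of their domains, then there is a linear order `σ` of
`X` whose restriction to each `L i` equals `σs i`. -/
theorem sequential_orders_extend
    {X : Type*} [Fintype X] (k : ℕ) (L : ℕ → Set X)
    (hcover : ∀ x : X, ∃ i < k, x ∈ L i)
    (hconsec : ∀ (x : X) (i m j : ℕ), i ≤ m → m ≤ j → j < k →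
      x ∈ L i → x ∈ L j → x ∈ L m)
    (σs : ℕ → (X → X → Prop))
    (hlin : ∀ i < k, IsLinOrderOn (L i) (σs i))
    (hagree : ∀ i : ℕ, i + 1 < k → ∀ x ∈ L i ∩ L (i + 1), ∀ y ∈ L i ∩ L (i + 1),
      (σs i x y ↔ σs (i + 1) x y)) :
    ∃ σ : X → X → Prop, IsLinOrderOn Set.univ σ ∧
      ∀ i < k, restrictRel σ (L i) = σs i := by
  suffices H : ∀ n ≤ k, ∃ σ : X → X → Prop, IsLinOrderOn Set.univ σ ∧
      ∀ i < n, ∀ x y, σs i x y → σ x y by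
    obtain ⟨σ, hσ, hle⟩ := H k le_rfl
    exact ⟨σ, hσ, fun i hi => hσ.restrictRel_eq_of_le (hlin i hi) (hle i hi)⟩
  intro n
  induction n with
  | zero =>
    intro _
    have hempty : IsLinOrderOn (∅ : Set X) fun _ _ => False := by simp [IsLinOrderOn]
    obtain ⟨σ, hσ, -⟩ := hempty.exists_amalgam hempty (by simp)
    exact ⟨σ, hσ, by simp⟩
  | succ n ih =>
    intro hn
    obtain ⟨σ, hσ, hle⟩ := ih (by lia)
    let U : Set X := {x | ∃ i < n, x ∈ L i}
    obtain ⟨σ', hσ', h1, h2⟩ :=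
      (hσ.restrict (L := U)).exists_amalgam (hlin n (by lia)) (by
        rintro x ⟨⟨i, hi, hxi⟩, hxn⟩ y ⟨⟨j, hj, hyj⟩, hyn⟩
        obtain ⟨m, rfl⟩ : ∃ m, n = m + 1 := ⟨n - 1, by lia⟩
        have hx : x ∈ L m := hconsec x i m (m + 1) (by lia) (by lia) (by lia) hxi hxn
        have hy : y ∈ L m := hconsec y j m (m + 1) (by lia) (by lia) (by lia) hyj hyn
        rw [← hagree m (by lia) x ⟨hx, hxn⟩ y ⟨hy, hyn⟩,
          ← hσ.restrictRel_eq_of_le (hlin m (by lia)) (hle m (by lia))]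
        exact ⟨fun h => ⟨hx, hy, h.2.2⟩, fun h => ⟨⟨i, hi, hxi⟩, ⟨j, hj, hyj⟩, h.2.2⟩⟩)
    refine ⟨σ', hσ', fun i hi x y hxy => ?_⟩
    rcases Nat.lt_succ_iff_lt_or_eq.mp hi with hi | rfl
    · obtain ⟨hx, hy⟩ := (hlin i (by lia)).1 x y hxy
      exact h1 x y ⟨⟨i, hi, hx⟩, ⟨i, hi, hy⟩, hle i hi x y hxy⟩
    · exact h2 x y hxy
end

section
/- Let H and V be finite sets, E ⊆ H × V a relation, and ≼ a linear order of H. Suppose there exists a linear order τ of V such that for every h ∈ H there do not exist u, v, w ∈ V with u <_τ v <_τ w, (h,u) ∈ E, (h,w) ∈ E, v active at h, and (h,v) ∉ E. Then the instance ((H ∪ V, E), ≼) admits an HV-segment representation, i.e., there exist functions y, ℓ, r : H → ℝ and x, b, t : V → ℝ realizing the representation. -/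
/-- `(y, l, r, x, b, t)` is an HV-segment representation of the instance given by the
bipartite relation `E ⊆ H × V` and the linear order on `H`:
(i) `y` is strictly monotone with respect to the order on `H`;
(ii) each horizontal segment `[l h, r h] × {y h}` and vertical segment
`{x v} × [b v, t v]` is nonempty;
(iii) the segments of `h` and `v` intersect iff `E h v`;
(iv) distinct vertical segments do not overlap. -/
def IsHVRep {H V : Type*} [LinearOrder H] (E : H → V → Prop)
    (y l r : H → ℝ) (x b t : V → ℝ) : Prop :=
  (∀ h h' : H, h < h' → y h < y h') ∧
  (∀ h, l h ≤ r h) ∧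
  (∀ v, b v ≤ t v) ∧
  (∀ h v, (l h ≤ x v ∧ x v ≤ r h ∧ b v ≤ y h ∧ y h ≤ t v) ↔ E h v) ∧
  (∀ v v', v ≠ v' → x v = x v' → t v < b v' ∨ t v' < b v)

/-- The vertical segment `v` is active at the horizontal segment `h` if `v` has
neighbors `h₁ ≼ h` and `h₂ ≽ h`. -/
def ActiveAt {H V : Type*} [LinearOrder H] (E : H → V → Prop) (v : V) (h : H) : Prop :=
  ∃ h₁ h₂ : H, E h₁ v ∧ E h₂ v ∧ h₁ ≤ h ∧ h ≤ h₂

/-- A finite linear order embeds into the nonnegative reals. -/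
theorem exists_real_nonneg_le_iff {α : Type*} [Finite α] (r : α → α → Prop)
    (hr : IsLinearOrder α r) :
    ∃ f : α → ℝ, (∀ a, 0 ≤ f a) ∧ ∀ a b, f a ≤ f b ↔ r a b := by
  classical
  have := Fintype.ofFinite α
  let _ : LinearOrder α :=
    { le := r
      le_refl := refl_of r
      le_trans := fun _ _ _ => trans_of r
      le_antisymm := fun _ _ => antisymm_of r
      le_total := total_of r
      toDecidableLE := Classical.decRel _ }
  let e := (monoEquivOfFin α rfl).symm
  refine ⟨fun a => ((e a : ℕ) : ℝ), fun a => Nat.cast_nonneg _, fun a b => ?_⟩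
  rw [Nat.cast_le, Fin.val_fin_le, e.le_iff_le]
  rfl

/-- The hull of the values of `f` on a possibly empty finite set `p` is cut out on the
nonnegative reals by a nonempty closed interval. -/
theorem exists_interval_iff_between {α : Type*} [Finite α] (p : α → Prop) (f : α → ℝ) :
    ∃ a c : ℝ, a ≤ c ∧ ∀ z, 0 ≤ z →
      (a ≤ z ∧ z ≤ c ↔ ∃ u w, p u ∧ p w ∧ f u ≤ z ∧ z ≤ f w) := by
  rcases {u | p u}.eq_empty_or_nonempty with hp | hp
  · refine ⟨-1, -1, le_rfl, fun z hz => ⟨fun h => by linarith [h.2], ?_⟩⟩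
    rintro ⟨u, -, hu, -⟩
    exact absurd hu (Set.eq_empty_iff_forall_notMem.1 hp u)
  · obtain ⟨u, hu, hmin⟩ := Set.exists_min_image _ f (Set.toFinite _) hp
    obtain ⟨w, hw, hmax⟩ := Set.exists_max_image _ f (Set.toFinite _) hp
    refine ⟨f u, f w, hmin w hw, fun z _ => ⟨fun h => ⟨u, w, hu, hw, h⟩, ?_⟩⟩
    rintro ⟨u', w', hu', hw', h₁, h₂⟩
    exact ⟨(hmin u' hu').trans h₁, h₂.trans (hmax w' hw')⟩

/-- Sufficiency: if there is a linear order `τ` of `V` such that, for every `h ∈ H`, no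
segment active at `h` but not intersecting `h` lies `τ`-between two segments
intersecting `h`, then the instance admits an HV-segment representation. -/
theorem consecutive_order_gives_hv_representation
    {H V : Type*} [Fintype H] [Fintype V] [LinearOrder H] (E : H → V → Prop)
    (τ : V → V → Prop) (hτ : IsLinearOrder V τ)
    (hcons : ∀ h : H, ¬ ∃ u v w : V, (τ u v ∧ u ≠ v) ∧ (τ v w ∧ v ≠ w) ∧
      E h u ∧ E h w ∧ ActiveAt E v h ∧ ¬ E h v) :
    ∃ (y l r : H → ℝ) (x b t : V → ℝ), IsHVRep E y l r x b t := by
  obtain ⟨y, hy0, hy⟩ := exists_real_nonneg_le_iff (α := H) (· ≤ ·) inferInstance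
  obtain ⟨x, hx0, hx⟩ := exists_real_nonneg_le_iff τ hτ
  choose l r hlr hh using fun h => exists_interval_iff_between (E h) x
  choose b t hbt hv using fun v => exists_interval_iff_between (E · v) y
  refine ⟨y, l, r, x, b, t, fun h h' hlt => ?_, hlr, hbt, fun h v => ?_, fun v v' hne he => ?_⟩
  · exact lt_of_not_ge fun hle => hlt.not_ge ((hy _ _).1 hle)
  · rw [← and_assoc, hh h _ (hx0 v), hv v _ (hy0 h)]
    constructor
    · rintro ⟨⟨u, w, hu, hw, huv, hvw⟩, h₁, h₂, e₁, e₂, h₁h, hh₂⟩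
      by_contra hE
      exact hcons h ⟨u, v, w, ⟨(hx _ _).1 huv, fun e => hE (e ▸ hu)⟩,
        ⟨(hx _ _).1 hvw, fun e => hE (e ▸ hw)⟩, hu, hw,
        ⟨h₁, h₂, e₁, e₂, (hy _ _).1 h₁h, (hy _ _).1 hh₂⟩, hE⟩
    · exact fun hE => ⟨⟨v, v, hE, hE, le_rfl, le_rfl⟩, h, h, hE, hE, le_rfl, le_rfl⟩
  · exact absurd (antisymm_of τ ((hx _ _).1 he.le) ((hx _ _).1 he.ge)) hne
end
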